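/- Let α = (1+√5)/4 and β = (−1+√5)/4 (as real numbers, viewed in ℂ), and let C = [[α − (1/2)·i, −β·i], [−β·i, α + (1/2)·i]]. For k ≥ 1 let τ(Cᵏ) denote the trace of the ℂ-linear endomorphism of 𝔰𝔩₂(ℂ) given by X ↦ Cᵏ·X·C⁻ᵏ. Then τ(C) = (1+√5)/2, τ(C²) = (1−√5)/2, τ(C³) = (1−√5)/2, and consequently 2·( τ(C)·τ(C²) − τ(C³) ) = √5 − 3, which is nonzero. -/

import Mathlib

noncomputable section

/-- `𝔰𝔩₂(ℂ)`, the space of 2×2 complex matrices of trace zero, as a `ℂ`-subspace of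
the space of 2×2 complex matrices. -/
def sl2C : Submodule ℂ (Matrix (Fin 2) (Fin 2) ℂ) :=
  LinearMap.ker (Matrix.traceLinearMap (Fin 2) ℂ ℂ)

/-- Conjugation `X ↦ g·X·g⁻¹` as a `ℂ`-linear endomorphism of 2×2 matrices. -/
def conjMap (g : Matrix (Fin 2) (Fin 2) ℂ) :
    Matrix (Fin 2) (Fin 2) ℂ →ₗ[ℂ] Matrix (Fin 2) (Fin 2) ℂ where
  toFun X := g * X * g⁻¹
  map_add' X Y := by simp [Matrix.mul_add, Matrix.add_mul]
  map_smul' c X := by simp [Matrix.mul_smul, Matrix.smul_mul]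

/-- Conjugation preserves the trace-zero matrices. -/
theorem conjMap_mem_sl2C (g : Matrix (Fin 2) (Fin 2) ℂ) :
    ∀ X ∈ sl2C, conjMap g X ∈ sl2C := by
  intro X hX
  have hX' : X.trace = 0 := hX
  show (g * X * g⁻¹).trace = 0
  by_cases h : IsUnit g.det
  · rw [Matrix.trace_mul_comm, ← Matrix.mul_assoc, Matrix.nonsing_inv_mul _ h, one_mul, hX']
  · rw [Matrix.nonsing_inv_apply_not_isUnit _ h, Matrix.mul_zero, Matrix.trace_zero]

/-- `τ(g)`, the trace of the `ℂ`-linear endomorphism `X ↦ g·X·g⁻¹` of `𝔰𝔩₂(ℂ)`. -/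
def τ (g : Matrix (Fin 2) (Fin 2) ℂ) : ℂ :=
  LinearMap.trace ℂ sl2C ((conjMap g).restrict (conjMap_mem_sl2C g))

/-- `α = (1+√5)/4`. -/
def α : ℂ := (((1 + Real.sqrt 5) / 4 : ℝ) : ℂ)

/-- `β = (−1+√5)/4`. -/
def β : ℂ := (((-1 + Real.sqrt 5) / 4 : ℝ) : ℂ)

/-- `C = ρ(x₃)`. -/
def Cρ : Matrix (Fin 2) (Fin 2) ℂ :=
  !![α - (1 / 2) * Complex.I, -β * Complex.I; -β * Complex.I, α + (1 / 2) * Complex.I]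

/-- Coordinates `!![a, b; c, -a] ↦ (a, b, c)` on the trace-zero matrices. -/
def sl2CEquivFun : sl2C ≃ₗ[ℂ] (Fin 3 → ℂ) where
  toFun X := ![X.1 0 0, X.1 0 1, X.1 1 0]
  map_add' X Y := by ext i; fin_cases i <;> simp
  map_smul' c X := by ext i; fin_cases i <;> simp
  invFun v := ⟨!![v 0, v 1; v 2, -v 0], by simp [sl2C, Matrix.trace_fin_two]⟩
  left_inv X := by
    have hX : X.1 0 0 + X.1 1 1 = 0 := by
      rw [← Matrix.trace_fin_two]
      exact X.2
    ext i j
    fin_cases i <;> fin_cases j <;> simp [neg_eq_of_add_eq_zero_right hX]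
  right_inv v := by ext i; fin_cases i <;> simp

theorem τ_eq_trace_sq_sub_one {g : Matrix (Fin 2) (Fin 2) ℂ} (hg : g.det = 1) :
    τ g = g.trace ^ 2 - 1 := by
  have hinv : g⁻¹ = !![g 1 1, -g 0 1; -g 1 0, g 0 0] := by
    rw [Matrix.inv_def, hg, Matrix.adjugate_fin_two]
    simp
  rw [Matrix.det_fin_two] at hg
  rw [τ, LinearMap.trace_eq_matrix_trace ℂ (Module.Basis.ofEquivFun sl2CEquivFun),
    Matrix.trace_fin_three, Matrix.trace_fin_two]
  simp [LinearMap.toMatrix_apply, sl2CEquivFun, conjMap, hinv, Matrix.mul_apply,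
    Fin.sum_univ_two]
  linear_combination -hg

theorem trace_sq_of_det_eq_one {g : Matrix (Fin 2) (Fin 2) ℂ} (hg : g.det = 1) :
    (g ^ 2).trace = g.trace ^ 2 - 2 := by
  rw [Matrix.det_fin_two] at hg
  simp only [pow_two g, Matrix.trace_fin_two, Matrix.mul_apply, Fin.sum_univ_two]
  linear_combination -2 * hg

theorem trace_cube_of_det_eq_one {g : Matrix (Fin 2) (Fin 2) ℂ} (hg : g.det = 1) :
    (g ^ 3).trace = g.trace ^ 3 - 3 * g.trace := by
  rw [Matrix.det_fin_two] at hg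
  simp only [pow_three g, Matrix.trace_fin_two, Matrix.mul_apply, Fin.sum_univ_two]
  linear_combination -3 * (g 0 0 + g 1 1) * hg

theorem ofReal_sqrt_five_sq : ((Real.sqrt 5 : ℝ) : ℂ) ^ 2 = 5 := by
  rw [← Complex.ofReal_pow, Real.sq_sqrt (by norm_num)]
  norm_num

theorem det_Cρ : Cρ.det = 1 := by
  rw [Cρ, Matrix.det_fin_two_of, α, β]
  push_cast
  linear_combination (1 / 8 : ℂ) * ofReal_sqrt_five_sq -
    (1 / 4 + ((-1 + (Real.sqrt 5 : ℂ)) / 4) ^ 2) * Complex.I_sq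

theorem trace_Cρ : Cρ.trace = (1 + (Real.sqrt 5 : ℂ)) / 2 := by
  rw [Cρ, Matrix.trace_fin_two_of, α]
  push_cast
  ring

/-- `τ(C) = (1+√5)/2`, `τ(C²) = τ(C³) = (1−√5)/2`, and hence
`2·(τ(C)·τ(C²) − τ(C³)) = √5 − 3 ≠ 0`. -/
theorem tau_C_values :
    τ Cρ = (((1 + Real.sqrt 5) / 2 : ℝ) : ℂ) ∧
    τ (Cρ ^ 2) = (((1 - Real.sqrt 5) / 2 : ℝ) : ℂ) ∧
    τ (Cρ ^ 3) = (((1 - Real.sqrt 5) / 2 : ℝ) : ℂ) ∧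
    2 * (τ Cρ * τ (Cρ ^ 2) - τ (Cρ ^ 3)) = ((Real.sqrt 5 - 3 : ℝ) : ℂ) ∧
    ((Real.sqrt 5 - 3 : ℝ) : ℂ) ≠ 0 := by
  have hs := ofReal_sqrt_five_sq
  have h₁ : τ Cρ = (((1 + Real.sqrt 5) / 2 : ℝ) : ℂ) := by
    rw [τ_eq_trace_sq_sub_one det_Cρ, trace_Cρ]
    push_cast
    linear_combination (1 / 4 : ℂ) * hs
  have h₂ : τ (Cρ ^ 2) = (((1 - Real.sqrt 5) / 2 : ℝ) : ℂ) := by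
    rw [τ_eq_trace_sq_sub_one (by rw [Matrix.det_pow, det_Cρ, one_pow]),
      trace_sq_of_det_eq_one det_Cρ, trace_Cρ]
    push_cast
    grind
  have h₃ : τ (Cρ ^ 3) = (((1 - Real.sqrt 5) / 2 : ℝ) : ℂ) := by
    rw [τ_eq_trace_sq_sub_one (by rw [Matrix.det_pow, det_Cρ, one_pow]),
      trace_cube_of_det_eq_one det_Cρ, trace_Cρ]
    push_cast
    grind
  refine ⟨h₁, h₂, h₃, ?_, ?_⟩
  · rw [h₁, h₂, h₃]
    push_cast
    linear_combination (-1 / 2 : ℂ) * hs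
  · rw [Complex.ofReal_ne_zero, sub_ne_zero]
    exact ((Real.sqrt_lt' (by norm_num)).2 (by norm_num)).ne

end
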